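/- (Fraïssé–Pouzet) An infinite structure Y in a relational first-order language L is monomorphic if and only if Y is chainable, i.e., there is a linear order < on the domain of Y such that every partial automorphism of (Y,<) (every order-preserving bijection between two finite subsets of the domain) is a partial automorphism of Y (preserves every relation of Y in both directions). -/

import Mathlib

open FirstOrder Cardinal

universe u v w w' x

/-- The substructure of an `L`-structure induced on a subset of its domain
(for a relational language every subset is the domain of an induced substructure). -/
def inducedStructure (L : FirstOrder.Language.{u, v}) [L.IsRelational] {M : Type w}
    [L.Structure M] (s : Set M) : L.Structure s where
  funMap f := isEmptyElim f
  RelMap R v := FirstOrder.Language.Structure.RelMap R (fun i => (v i : M))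

/-- A structure `M` is monomorphic if for every (positive) natural number `n`, any two
`n`-element subsets of its domain carry isomorphic induced substructures. -/
def IsMonomorphic (L : FirstOrder.Language.{u, v}) [L.IsRelational] (M : Type w)
    [L.Structure M] : Prop :=
  ∀ s t : Set M, s.Finite → t.Finite → s.ncard = t.ncard →
    Nonempty (@FirstOrder.Language.Equiv L s t (inducedStructure L s) (inducedStructure L t))

/-- A predicate on lists of length `k` holds generically along the filter `U` if it holds for
`U`-almost all first entries, `U`-almost all second entries, and so on. -/
def GenericallyHolds {M : Type*} (U : Filter M) : ℕ → (List M → Prop) → Prop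
  | 0, P => P []
  | k + 1, P => ∀ᶠ x in U, GenericallyHolds U k (fun l => P (x :: l))

/-- A finite Ramsey-type statement: for finitely many predicates on lists there are arbitrarily
long lists whose sublists all behave generically. -/
theorem exists_list_forall_sublist_iff_genericallyHolds {M : Type*} (U : Ultrafilter M)
    (hU : (U : Filter M) ≤ Filter.cofinite) (m : ℕ) :
    ∀ (S : Set (ℕ × (List M → Prop))), S.Finite → ∀ F : Set M, F.Finite →
      ∃ a : List M, a.length = m ∧ a.Nodup ∧ (∀ y ∈ a, y ∉ F) ∧
        ∀ p ∈ S, ∀ l : List M, l.Sublist a → l.length = p.1 →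
          (p.2 l ↔ GenericallyHolds (U : Filter M) p.1 p.2) := by
  induction m with
  | zero =>
    intro S _ F _
    refine ⟨[], rfl, List.nodup_nil, by simp, ?_⟩
    rintro ⟨k, P⟩ _ l hl hk
    obtain rfl := List.sublist_nil.1 hl
    obtain rfl : k = 0 := by simpa using hk.symm
    rfl
  | succ m ih =>
    intro S hS F hF
    have hgeneric : ∀ᶠ x in (U : Filter M), ∀ p ∈ S, ∀ k, p.1 = k + 1 →
        (GenericallyHolds (U : Filter M) k (fun l => p.2 (x :: l)) ↔
          GenericallyHolds (U : Filter M) p.1 p.2) := by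
      rw [Filter.eventually_all_finite hS]
      rintro ⟨k, P⟩ _
      cases k with
      | zero => simp
      | succ k =>
        by_cases h : GenericallyHolds (U : Filter M) (k + 1) P
        · have h' := h
          rw [GenericallyHolds] at h'
          filter_upwards [h'] with x hx
          rintro _ ⟨⟩
          exact iff_of_true hx h
        · have h' := h
          rw [GenericallyHolds, ← Ultrafilter.eventually_not] at h'
          filter_upwards [h'] with x hx
          rintro _ ⟨⟩
          exact iff_of_false hx h
    have hnew : ∀ᶠ x in (U : Filter M), x ∉ F := hU hF.compl_mem_cofinite
    obtain ⟨x, hx, hxF⟩ := (hgeneric.and hnew).exists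
    obtain ⟨a, hlen, hnodup, hF', ha⟩ := ih
      (S ∪ (fun p : ℕ × (List M → Prop) => (p.1 - 1, fun l => p.2 (x :: l))) '' S)
      (hS.union (hS.image _)) (insert x F) (hF.insert x)
    refine ⟨x :: a, by simp [hlen], ?_, ?_, ?_⟩
    · exact List.nodup_cons.2 ⟨fun h => hF' x h (Set.mem_insert _ _), hnodup⟩
    · intro y hy
      rcases List.mem_cons.1 hy with rfl | hy
      · exact hxF
      · exact fun h => hF' y hy (Set.mem_insert_of_mem _ h)
    · intro p hp l hl hk
      rcases List.sublist_cons_iff.1 hl with hl' | ⟨l, rfl, hl'⟩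
      · exact ha p (Or.inl hp) l hl' hk
      · have hk' : p.1 = l.length + 1 := by simpa using hk.symm
        have := ha _ (Or.inr ⟨p, hp, rfl⟩) l hl' (by simp [hk'])
        rw [← hx p hp l.length hk']
        simpa [hk'] using this

/-- Two tuples in `Fin m` with the same order pattern factor through a common map
followed by strictly monotone maps. -/
theorem exists_strictMono_factorization {n m : ℕ} (p q : Fin n → Fin m)
    (h : ∀ i j, p i < p j ↔ q i < q j) :
    ∃ (k : ℕ) (σ : Fin n → Fin k) (ρ τ : Fin k → Fin m),
      StrictMono ρ ∧ StrictMono τ ∧ p = ρ ∘ σ ∧ q = τ ∘ σ := by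
  have heq : ∀ i j, p i = p j → q i = q j := fun i j hij =>
    le_antisymm (not_lt.1 fun hlt => ((h j i).2 hlt).ne hij.symm)
      (not_lt.1 fun hlt => ((h i j).2 hlt).ne hij)
  let e := (Finset.univ.image p).orderIsoOfFin rfl
  let σ : Fin n → Fin (Finset.univ.image p).card := fun i =>
    e.symm ⟨p i, Finset.mem_image_of_mem p (Finset.mem_univ i)⟩
  have hσ : ∀ i, (e (σ i) : Fin m) = p i := fun i => by simp [σ]
  have hsurj : Function.Surjective σ := by
    intro y
    obtain ⟨i, -, hi⟩ := Finset.mem_image.1 (e y).2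
    exact ⟨i, e.injective (Subtype.ext (by rw [hσ, hi]))⟩
  have hinv : ∀ y, p (Function.surjInv hsurj y) = e y := fun y => by
    rw [← hσ, Function.surjInv_eq hsurj]
  refine ⟨_, σ, fun y => e y, q ∘ Function.surjInv hsurj, fun y z hyz => e.strictMono hyz,
    fun y z hyz => ?_, funext fun i => (hσ i).symm, funext fun i => ?_⟩
  · refine (h _ _).1 ?_
    rw [hinv, hinv]
    exact e.strictMono hyz
  · refine heq _ _ ?_
    rw [hinv, hσ]

theorem List.ofFn_comp_get_sublist {α : Type*} (a : List α) {k : ℕ} {ρ : Fin k → Fin a.length}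
    (hρ : StrictMono ρ) : (List.ofFn fun i => a.get (ρ i)).Sublist a := by
  rw [List.sublist_iff_exists_fin_orderEmbedding_get_eq]
  refine ⟨OrderEmbedding.ofStrictMono
    (fun i => ρ (Fin.cast (List.length_ofFn) i)) fun i j hij => hρ hij, fun i => ?_⟩
  simp [Fin.cast]

/-- In an infinite structure, finitely many relations admit arbitrarily long lists of
order-indiscernible elements. -/
theorem exists_indiscernible_list (L : FirstOrder.Language.{u, v}) (M : Type w) [L.Structure M]
    [Infinite M] (T : Finset (Σ n, L.Relations n)) (m : ℕ) :
    ∃ a : List M, a.length = m ∧ a.Nodup ∧ ∀ t ∈ T, ∀ p q : Fin t.1 → Fin a.length,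
      (∀ i j, p i < p j ↔ q i < q j) →
      (FirstOrder.Language.Structure.RelMap t.2 (fun i => a.get (p i)) ↔
        FirstOrder.Language.Structure.RelMap t.2 (fun i => a.get (q i))) := by
  obtain ⟨d⟩ := (inferInstance : Nonempty M)
  let P : (Σ t : T, Σ k : Fin (m + 1), Fin t.1.1 → Fin k) → ℕ × (List M → Prop) := fun c =>
    (c.2.1, fun l => FirstOrder.Language.Structure.RelMap c.1.1.2
      (fun i => l.getD (c.2.2 i) d))
  obtain ⟨a, hlen, hnodup, -, ha⟩ := exists_list_forall_sublist_iff_genericallyHolds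
    (Filter.hyperfilter M) (Filter.hyperfilter_le_cofinite) m (Set.range P) (Set.finite_range P)
    ∅ Set.finite_empty
  refine ⟨a, hlen, hnodup, fun t ht p q hpq => ?_⟩
  obtain ⟨k, σ, ρ, τ, hρ, hτ, rfl, rfl⟩ := exists_strictMono_factorization p q hpq
  have hk : k < m + 1 := by
    have := Fintype.card_le_of_injective ρ hρ.injective
    simp only [Fintype.card_fin] at this
    omega
  have key := ha (P ⟨⟨t, ht⟩, ⟨k, hk⟩, σ⟩) ⟨_, rfl⟩
  have h := (key _ (a.ofFn_comp_get_sublist hρ) (by simp [P])).trans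
    (key _ (a.ofFn_comp_get_sublist hτ) (by simp [P])).symm
  simpa [P] using h

/-- Every finite part of an infinite monomorphic structure can be ordered so that finitely many
given relations are determined by the order pattern. -/
theorem IsMonomorphic.exists_rank {L : FirstOrder.Language.{u, v}} [L.IsRelational] {M : Type w}
    [L.Structure M] [Infinite M] (hM : IsMonomorphic L M) (T : Finset (Σ n, L.Relations n))
    (F : Finset M) :
    ∃ g : M → ℕ, Set.InjOn g F ∧ ∀ t ∈ T, ∀ v w : Fin t.1 → M, (∀ i, v i ∈ F) →
      (∀ i, w i ∈ F) → (∀ i j, g (v i) < g (v j) ↔ g (w i) < g (w j)) →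
      (FirstOrder.Language.Structure.RelMap t.2 v ↔
        FirstOrder.Language.Structure.RelMap t.2 w) := by
  classical
  obtain ⟨a, hlen, hnodup, ha⟩ := exists_indiscernible_list L M T F.card
  obtain ⟨e, he⟩ : ∃ e : (F : Set M) ≃ {x | x ∈ a}, ∀ (n : ℕ) (R : L.Relations n)
      (v : Fin n → (F : Set M)),
      (FirstOrder.Language.Structure.RelMap R (fun i => (e (v i) : M)) ↔
        FirstOrder.Language.Structure.RelMap R (fun i => (v i : M))) := by
    let := inducedStructure L (F : Set M)
    let := inducedStructure L {x | x ∈ a}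
    obtain ⟨e⟩ := hM (F : Set M) {x | x ∈ a} F.finite_toSet a.finite_toSet (by
      rw [Set.ncard_coe_finset, ← hlen, ← List.toFinset_card_of_nodup hnodup,
        ← Set.ncard_coe_finset, List.coe_toFinset])
    exact ⟨e.toEquiv, fun n R v => e.map_rel' R v⟩
  let φ : M → M := fun x => if h : x ∈ F then (e ⟨x, h⟩ : M) else x
  have hφ : ∀ x (h : x ∈ F), φ x = e ⟨x, h⟩ := fun x h => dif_pos h
  have hmem : ∀ x ∈ F, φ x ∈ a := fun x h => by
    rw [hφ x h]
    exact (e ⟨x, h⟩).2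
  have hrel : ∀ (n : ℕ) (R : L.Relations n) (v : Fin n → M), (∀ i, v i ∈ F) →
      (FirstOrder.Language.Structure.RelMap R (fun i => φ (v i)) ↔
        FirstOrder.Language.Structure.RelMap R v) := fun n R v hv => by
    have h := he n R (fun i => ⟨v i, hv i⟩)
    have hφv : (fun i => φ (v i)) = fun i => (e ⟨v i, hv i⟩ : M) :=
      funext fun i => hφ _ (hv i)
    rw [hφv]
    exact h
  refine ⟨fun x => a.idxOf (φ x), fun x hx y hy hxy => ?_, fun t ht v w hv hw hvw => ?_⟩
  · have h := (List.idxOf_inj (hmem x hx)).1 hxy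
    rw [hφ x hx, hφ y hy] at h
    simpa using e.injective (Subtype.ext h)
  · rw [← hrel _ _ v hv, ← hrel _ _ w hw]
    have h := ha t ht (fun i => ⟨a.idxOf (φ (v i)), List.idxOf_lt_length_of_mem (hmem _ (hv i))⟩)
      (fun i => ⟨a.idxOf (φ (w i)), List.idxOf_lt_length_of_mem (hmem _ (hw i))⟩) hvw
    simpa using h

/-- An infinite monomorphic structure carries a linear order whose order patterns determine all
relations: the ranks of the finite parts converge along an ultrafilter. -/
theorem IsMonomorphic.exists_linearOrder {L : FirstOrder.Language.{u, v}} [L.IsRelational]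
    {M : Type w} [L.Structure M] [Infinite M] (hM : IsMonomorphic L M) :
    ∃ lo : LinearOrder M, ∀ (n : ℕ) (R : L.Relations n) (v w : Fin n → M),
      (∀ i j, lo.lt (v i) (v j) ↔ lo.lt (w i) (w j)) →
      (FirstOrder.Language.Structure.RelMap R v ↔
        FirstOrder.Language.Structure.RelMap R w) := by
  classical
  choose g hinj hg using
    fun c : Finset (Σ n, L.Relations n) × Finset M => hM.exists_rank c.1 c.2
  let V := Ultrafilter.of (Filter.atTop : Filter (Finset (Σ n, L.Relations n) × Finset M))
  have hV : ∀ c, ∀ᶠ i in (V : Filter (Finset (Σ n, L.Relations n) × Finset M)), c ≤ i := fun c =>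
    Ultrafilter.of_le _ (Filter.eventually_ge_atTop c)
  let lo : LinearOrder M :=
    { le := fun x y => ∀ᶠ i in (V : Filter _), g i x ≤ g i y
      le_refl := fun x => Filter.Eventually.of_forall fun i => le_rfl
      le_trans := fun x y z hxy hyz => by
        filter_upwards [hxy, hyz] with i h h' using h.trans h'
      le_antisymm := fun x y hxy hyx => by
        obtain ⟨i, h, h', hi⟩ := (hxy.and (hyx.and (hV (∅, {x, y})))).exists
        exact hinj i (hi.2 (by simp)) (hi.2 (by simp)) (le_antisymm h h')
      le_total := fun x y => Ultrafilter.eventually_or.1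
        (Filter.Eventually.of_forall fun i => le_total _ _)
      toDecidableLE := Classical.decRel _ }
  have hlt : ∀ x y, lo.lt x y ↔ ∀ᶠ i in (V : Filter _), g i x < g i y := fun x y => by
    rw [show lo.lt x y ↔ ¬ lo.le y x from lt_iff_not_ge]
    change ¬ (∀ᶠ i in (V : Filter _), g i y ≤ g i x) ↔ _
    rw [← Ultrafilter.eventually_not]
    simp only [not_le]
  refine ⟨lo, fun n R v w hvw => ?_⟩
  have hdecide : ∀ x y, ∀ᶠ i in (V : Filter _), (g i x < g i y ↔ lo.lt x y) := fun x y => by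
    by_cases h : lo.lt x y
    · filter_upwards [(hlt x y).1 h] with i hi using iff_of_true hi h
    · have h' := h
      rw [hlt, ← Ultrafilter.eventually_not] at h'
      filter_upwards [h'] with i hi using iff_of_false hi h
  have hpattern : ∀ u : Fin n → M, ∀ᶠ i in (V : Filter _), ∀ j k,
      (g i (u j) < g i (u k) ↔ lo.lt (u j) (u k)) := fun u =>
    Filter.eventually_all.2 fun j => Filter.eventually_all.2 fun k => hdecide _ _
  obtain ⟨i, hv, hw, hi⟩ := ((hpattern v).and ((hpattern w).and
    (hV ({⟨n, R⟩}, Finset.univ.image v ∪ Finset.univ.image w)))).exists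
  exact hg i ⟨n, R⟩ (hi.1 (by simp)) v w (fun j => hi.2 (by simp)) (fun j => hi.2 (by simp))
    fun j k => by rw [hv, hw, hvw]

/-- **Fraïssé–Pouzet theorem.** An infinite structure in a relational language is
monomorphic iff it is chainable: there is a linear order on its domain such that every
order-preserving map between finite subsets of the domain is a partial automorphism,
i.e., preserves every relation of the structure in both directions. -/
theorem monomorphic_iff_chainable
    (L : FirstOrder.Language.{u, v}) [L.IsRelational] (M : Type w) [L.Structure M]
    [Infinite M] :
    IsMonomorphic L M ↔
      ∃ lo : LinearOrder M, ∀ s : Set M, s.Finite → ∀ f : s → M,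
        (∀ a b : s, lo.lt a.1 b.1 ↔ lo.lt (f a) (f b)) →
        ∀ (n : ℕ) (R : L.Relations n) (v : Fin n → s),
          (FirstOrder.Language.Structure.RelMap R (fun i => (v i : M)) ↔
            FirstOrder.Language.Structure.RelMap R (fun i => f (v i))) := by
  constructor
  · intro hM
    obtain ⟨lo, hlo⟩ := hM.exists_linearOrder
    exact ⟨lo, fun s _ f hf n R v => hlo n R _ _ fun i j => hf (v i) (v j)⟩
  · rintro ⟨lo, hlo⟩ s t hs ht hst
    have hcard : hs.toFinset.card = ht.toFinset.card := by
      rw [← Set.ncard_eq_toFinset_card s hs, ← Set.ncard_eq_toFinset_card t ht, hst]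
    let e := (hs.toFinset.orderIsoOfFin rfl).symm.trans (ht.toFinset.orderIsoOfFin hcard.symm)
    let e' : s ≃ t := (Equiv.subtypeEquivRight fun x => hs.mem_toFinset.symm).trans
      (e.toEquiv.trans (Equiv.subtypeEquivRight fun x => ht.mem_toFinset))
    refine ⟨@FirstOrder.Language.Equiv.mk L s t (inducedStructure L s) (inducedStructure L t) e'
      (fun f => isEmptyElim f) fun {n} R v => ?_⟩
    refine (hlo s hs (fun x => (e' x : M)) (fun a b => ?_) n R v).symm
    exact (e.lt_iff_lt (x := ⟨a.1, hs.mem_toFinset.2 a.2⟩)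
      (y := ⟨b.1, hs.mem_toFinset.2 b.2⟩)).symm
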